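/- Let H₁, …, H_m ∈ ℂ^{n×n} be Hermitian and h₁, …, h_m ∈ ℝ. For every X ∈ S_{2n} with X positive semidefinite and Tr(Λ(H_i) X) ≤ h_i for i = 1,…,m, there exists X̃ ∈ S_{2n} positive semidefinite whose first diagonal entry is 0 and such that Tr(Λ(H) X̃) = Tr(Λ(H) X) for every Hermitian H ∈ ℂ^{n×n}. In particular, adding the constraint X₁₁ = 0 to the real semidefinite relaxation SDP-ℝ (minimizing Tr(Λ(H₀) X) over positive semidefinite X ∈ S_{2n} with Tr(Λ(H_i) X) ≤ h_i) does not change its optimal value. -/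

import Mathlib

open scoped ComplexOrder
open Matrix

noncomputable section

/-- The ring homomorphism `Λ` sending a complex matrix `Z` to the real matrix
`[[Re Z, −Im Z],[Im Z, Re Z]]`. -/
def Lam {n : ℕ} (Z : Matrix (Fin n) (Fin n) ℂ) :
    Matrix (Fin n ⊕ Fin n) (Fin n ⊕ Fin n) ℝ :=
  Matrix.fromBlocks (Z.map Complex.re) (-(Z.map Complex.im))
    (Z.map Complex.im) (Z.map Complex.re)

/-- Optimal value of SDP-ℝ, with an optional constraint `X₁₁ = 0` on the first
diagonal entry (imposed when `c = true`). -/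
def valSDPR (n m : ℕ) (hn : 0 < n) (H0 : Matrix (Fin n) (Fin n) ℂ)
    (H : Fin m → Matrix (Fin n) (Fin n) ℂ) (h : Fin m → ℝ) (c : Bool) : EReal :=
  sInf {x : EReal | ∃ X : Matrix (Fin n ⊕ Fin n) (Fin n ⊕ Fin n) ℝ,
    X.IsSymm ∧ X.PosSemidef ∧ (∀ i, (Lam (H i) * X).trace ≤ h i) ∧
    (c = true → X (Sum.inl ⟨0, hn⟩) (Sum.inl ⟨0, hn⟩) = 0) ∧
    x = (((Lam H0 * X).trace : ℝ) : EReal)}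

theorem lam_trace_aux {n : ℕ} (G : Matrix (Fin n) (Fin n) ℂ)
    (B : Matrix (Fin n ⊕ Fin n) (Fin n ⊕ Fin n) ℝ) :
    (Lam G * (Bᵀ * B)).trace = ∑ i, ∑ j, ∑ k,
      ((G i j).re * (B k (Sum.inl j) * B k (Sum.inl i) + B k (Sum.inr j) * B k (Sum.inr i))
       + (G i j).im * (B k (Sum.inl j) * B k (Sum.inr i) - B k (Sum.inr j) * B k (Sum.inl i))) := by
  simp only [Matrix.trace, Matrix.diag, Matrix.mul_apply, Fintype.sum_sum_type, Lam,
    Matrix.fromBlocks_apply₁₁, Matrix.fromBlocks_apply₁₂, Matrix.fromBlocks_apply₂₁,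
    Matrix.fromBlocks_apply₂₂, Matrix.map_apply, Matrix.neg_apply, Matrix.transpose_apply]
  simp only [← Finset.sum_add_distrib]
  refine Finset.sum_congr rfl fun i _ => Finset.sum_congr rfl fun j _ => ?_
  simp only [Finset.mul_sum, ← Finset.sum_add_distrib]
  refine Finset.sum_congr rfl fun k _ => ?_
  ring

theorem phase_aux (u v : ℝ) : ∃ a s : ℝ, a ^ 2 + s ^ 2 = 1 ∧ a * u - s * v = 0 := by
  by_cases h0 : u ^ 2 + v ^ 2 = 0
  · exact ⟨1, 0, by norm_num, by nlinarith [sq_nonneg u, sq_nonneg v]⟩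
  · have hp : 0 < u ^ 2 + v ^ 2 := lt_of_le_of_ne (by positivity) (Ne.symm h0)
    refine ⟨v / √(u ^ 2 + v ^ 2), u / √(u ^ 2 + v ^ 2), ?_, by ring⟩
    rw [div_pow, div_pow, Real.sq_sqrt hp.le]
    field_simp
    ring

open scoped MatrixOrder Matrix.Norms.L2Operator in
theorem fact_aux {ι : Type} [Fintype ι] [DecidableEq ι] (X : Matrix ι ι ℝ)
    (hX : X.PosSemidef) : ∃ B : Matrix ι ι ℝ, X = star B * B :=
  CStarAlgebra.nonneg_iff_eq_star_mul_self.mp hX.nonneg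

theorem exists_aux (n : ℕ) (hn : 0 < n) (X : Matrix (Fin n ⊕ Fin n) (Fin n ⊕ Fin n) ℝ)
    (hX : X.PosSemidef) :
    ∃ Xt : Matrix (Fin n ⊕ Fin n) (Fin n ⊕ Fin n) ℝ,
        Xt.IsSymm ∧ Xt.PosSemidef ∧ Xt (Sum.inl ⟨0, hn⟩) (Sum.inl ⟨0, hn⟩) = 0 ∧
        ∀ G : Matrix (Fin n) (Fin n) ℂ, (Lam G * Xt).trace = (Lam G * X).trace := by
  obtain ⟨B, hB⟩ : ∃ B : Matrix (Fin n ⊕ Fin n) (Fin n ⊕ Fin n) ℝ, X = Bᵀ * B := by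
    obtain ⟨B, hB⟩ := fact_aux X hX
    exact ⟨B, by rw [hB, Matrix.star_eq_conjTranspose, Matrix.conjTranspose_eq_transpose_of_trivial]⟩
  choose a s has h0 using fun k => phase_aux (B k (Sum.inl ⟨0, hn⟩)) (B k (Sum.inr ⟨0, hn⟩))
  let C : Matrix (Fin n ⊕ Fin n) (Fin n ⊕ Fin n) ℝ := fun k =>
    Sum.elim (fun i => a k * B k (Sum.inl i) - s k * B k (Sum.inr i))
      (fun i => s k * B k (Sum.inl i) + a k * B k (Sum.inr i))
  refine ⟨Cᵀ * C, ?_, ?_, ?_, ?_⟩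
  · simp [Matrix.IsSymm, Matrix.transpose_mul]
  · have := Matrix.posSemidef_conjTranspose_mul_self C
    rwa [Matrix.conjTranspose_eq_transpose_of_trivial] at this
  · rw [Matrix.mul_apply]
    refine Finset.sum_eq_zero fun k _ => ?_
    simp only [Matrix.transpose_apply, C, Sum.elim_inl, h0, mul_zero]
  · intro G
    rw [hB, lam_trace_aux, lam_trace_aux]
    refine Finset.sum_congr rfl fun i _ => Finset.sum_congr rfl fun j _ =>
      Finset.sum_congr rfl fun k _ => ?_
    simp only [C, Sum.elim_inl, Sum.elim_inr]
    linear_combination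
      ((G i j).re * (B k (Sum.inl j) * B k (Sum.inl i) + B k (Sum.inr j) * B k (Sum.inr i))
       + (G i j).im * (B k (Sum.inl j) * B k (Sum.inr i) - B k (Sum.inr j) * B k (Sum.inl i)))
       * has k

/-- Any feasible point of SDP-ℝ can be replaced by a feasible point with vanishing
first diagonal entry and the same value against every Hermitian matrix; in particular,
adding the constraint `X₁₁ = 0` to SDP-ℝ does not change its optimal value. -/
theorem stmt2 (n m : ℕ) (hn : 0 < n) (H0 : Matrix (Fin n) (Fin n) ℂ)
    (H : Fin m → Matrix (Fin n) (Fin n) ℂ) (h : Fin m → ℝ)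
    (hH0 : H0.IsHermitian) (hH : ∀ i, (H i).IsHermitian) :
    (∀ X : Matrix (Fin n ⊕ Fin n) (Fin n ⊕ Fin n) ℝ,
      X.IsSymm → X.PosSemidef → (∀ i, (Lam (H i) * X).trace ≤ h i) →
      ∃ Xt : Matrix (Fin n ⊕ Fin n) (Fin n ⊕ Fin n) ℝ,
        Xt.IsSymm ∧ Xt.PosSemidef ∧ Xt (Sum.inl ⟨0, hn⟩) (Sum.inl ⟨0, hn⟩) = 0 ∧
        ∀ G : Matrix (Fin n) (Fin n) ℂ, G.IsHermitian →
          (Lam G * Xt).trace = (Lam G * X).trace) ∧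
    valSDPR n m hn H0 H h true = valSDPR n m hn H0 H h false := by
  refine ⟨fun X _ hX _ => ?_, ?_⟩
  · obtain ⟨Xt, h1, h2, h3, h4⟩ := exists_aux n hn X hX
    exact ⟨Xt, h1, h2, h3, fun G _ => h4 G⟩
  · unfold valSDPR
    congr 1
    ext x
    constructor
    · rintro ⟨X, h1, h2, h3, -, h5⟩
      exact ⟨X, h1, h2, h3, by simp, h5⟩
    · rintro ⟨X, -, h2, h3, -, h5⟩
      obtain ⟨Xt, g1, g2, g3, g4⟩ := exists_aux n hn X h2
      exact ⟨Xt, g1, g2, fun i => by rw [g4]; exact h3 i, fun _ => g3, by rw [g4]; exact h5⟩
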